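/- arXiv:1510.02498 — 4 statements merged into one kernel-verified Lean document; each statement's English description precedes it below -/
import Mathlib

section
/- Let p ≥ 2 be a natural number. Then p is prime if and only if for every d with 1 ≤ d ≤ p−1, the integer K(p−1,d) = C(p−1,d) + (−1)^{d+1} is divisible by p; that is, p is prime if and only if all entries of the (p−1)-th row of Alkarkhi's triangle are congruent to 0 modulo p. -/
/-- Alkarkhi's triangle entry `K(n,d) = C(n,d) + (-1)^(d+1)`. -/
def K (n d : ℕ) : ℤ := (n.choose d : ℤ) + (-1) ^ (d + 1)

theorem K_add_K_succ (n d : ℕ) : K n d + K n (d + 1) = ((n + 1).choose (d + 1) : ℤ) := by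
  simp only [K, Nat.choose_succ_succ, Nat.cast_add, pow_succ]
  ring

theorem Nat.Prime.dvd_K {n : ℕ} (hn : (n + 1).Prime) {d : ℕ} (hd : d ≤ n) :
    ((n + 1 : ℕ) : ℤ) ∣ K n d := by
  induction d with
  | zero => simp [K]
  | succ d ih =>
    refine (dvd_add_right (ih (by lia))).mp ?_
    rw [K_add_K_succ]
    exact Int.natCast_dvd_natCast.mpr (hn.dvd_choose_self (by lia) (by lia))

theorem prime_of_forall_dvd_K {n : ℕ} (hn : 1 ≤ n)
    (h : ∀ d : ℕ, 1 ≤ d → d ≤ n → ((n + 1 : ℕ) : ℤ) ∣ K n d) : (n + 1).Prime := by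
  by_contra hnp
  have hq : (n + 1).minFac.Prime := Nat.minFac_prime (by lia)
  have hlt : (n + 1).minFac < n + 1 := (Nat.not_prime_iff_minFac_lt (by lia)).mp hnp
  obtain ⟨m, hm⟩ := Nat.minFac_dvd (n + 1)
  obtain ⟨k, hk⟩ : ∃ k, (n + 1).minFac = k + 1 := ⟨_, (Nat.succ_pred hq.ne_zero).symm⟩
  rw [hk] at hq hlt hm
  have hk1 : 1 ≤ k := by have := hq.two_le; lia
  have hdvd : n + 1 ∣ (n + 1).choose (k + 1) := by
    rw [← Int.natCast_dvd_natCast, ← K_add_K_succ]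
    exact dvd_add (h k hk1 (by lia)) (h (k + 1) (by lia) (by lia))
  have hchoose : (n + 1).choose (k + 1) = m * n.choose k := by
    have := Nat.add_one_mul_choose_eq n k
    refine Nat.eq_of_mul_eq_mul_right k.succ_pos ?_
    rw [Nat.succ_eq_add_one, ← this, hm]
    ring
  have hm0 : 0 < m := Nat.pos_of_ne_zero (by rintro rfl; simp at hm)
  have hqC : k + 1 ∣ n.choose k := by
    rw [hchoose, hm, mul_comm] at hdvd
    exact Nat.dvd_of_mul_dvd_mul_left hm0 hdvd
  have hqK : ((k + 1 : ℕ) : ℤ) ∣ K n k :=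
    (Int.natCast_dvd_natCast.mpr ⟨m, hm⟩).trans (h k hk1 (by lia))
  have hunit : ((k + 1 : ℕ) : ℤ) ∣ (-1) ^ (k + 1) :=
    (dvd_add_right (Int.natCast_dvd_natCast.mpr hqC)).mp hqK
  exact (Nat.prime_iff_prime_int.mp hq).not_isUnit
    (isUnit_of_dvd_unit hunit (isUnit_one.neg.pow _))

theorem alkarkhi_prime_iff_row_divisible (p : ℕ) (hp : 2 ≤ p) :
    p.Prime ↔ ∀ d : ℕ, 1 ≤ d → d ≤ p - 1 → (p : ℤ) ∣ K (p - 1) d := by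
  obtain ⟨n, rfl⟩ : ∃ n, p = n + 1 := ⟨p - 1, by lia⟩
  rw [Nat.add_sub_cancel]
  exact ⟨fun h _ _ hd => h.dvd_K hd, prime_of_forall_dvd_K (by lia)⟩
end

section
/- Let p ≥ 2 be a natural number. If for every d with 1 ≤ d ≤ p−1 the integer K(p−1,d) = C(p−1,d) + (−1)^{d+1} is divisible by p, then p is prime. -/
theorem alkarkhi_row_divisible_prime (p : ℕ) (hp : 2 ≤ p)
    (h : ∀ d : ℕ, 1 ≤ d → d ≤ p - 1 → (p : ℤ) ∣ K (p - 1) d) :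
    p.Prime := by
  obtain ⟨n, rfl⟩ : ∃ n, p = n + 1 := ⟨p - 1, by omega⟩
  simp only [Nat.add_sub_cancel] at h
  have hK : ∀ d ≤ n, ((n + 1 : ℕ) : ℤ) ∣ K n d := by
    intro d hd
    rcases Nat.eq_zero_or_pos d with rfl | hd0
    · simp [K]
    · exact h d hd0 hd
  by_contra hnp
  have hq : (n + 1).minFac.Prime := Nat.minFac_prime (by omega)
  have hlt : (n + 1).minFac < n + 1 := (Nat.not_prime_iff_minFac_lt hp).1 hnp
  have hqdvd : (n + 1).minFac ∣ n + 1 := Nat.minFac_dvd _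
  generalize (n + 1).minFac = q at hq hlt hqdvd
  obtain ⟨k, rfl⟩ : ∃ k, q = k + 1 := ⟨q - 1, by have := hq.pos; omega⟩
  have hchoose : n + 1 ∣ (n + 1).choose (k + 1) := by
    have := dvd_add (hK k (by omega)) (hK (k + 1) (by omega))
    rw [K_add_K_succ] at this
    exact_mod_cast this
  have hprev : k + 1 ∣ n.choose k := by
    apply Nat.dvd_of_mul_dvd_mul_left n.succ_pos
    rw [Nat.succ_eq_add_one, Nat.add_one_mul_choose_eq]
    exact mul_dvd_mul_right hchoose _
  have hunit : ((k + 1 : ℕ) : ℤ) ∣ (-1) ^ (k + 1) := by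
    have hKq : ((k + 1 : ℕ) : ℤ) ∣ K n k :=
      (Int.natCast_dvd_natCast.2 hqdvd).trans (hK k (by omega))
    exact (dvd_add_right (Int.natCast_dvd_natCast.2 hprev)).1 hKq
  have hone : IsUnit ((k + 1 : ℕ) : ℤ) :=
    isUnit_of_dvd_unit hunit (isUnit_one.neg.pow _)
  exact hq.one_lt.ne' (Int.ofNat_isUnit.1 hone |> Nat.isUnit_iff.1)
end

section
/- For every natural number n ≥ 1 such that ⌊n/2⌋ is odd, the (n+1)-th Fibonacci number equals the sum of the entries of Alkarkhi's triangle along the rising diagonal: F_{n+1} = ∑_{d=1}^{⌊n/2⌋} K(n−d, d). -/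
theorem sum_Icc_neg_one_pow_succ (m : ℕ) :
    ∑ d ∈ Finset.Icc 1 m, (-1 : ℤ) ^ (d + 1) = if Odd m then 1 else 0 := by
  induction m with
  | zero => simp
  | succ k ih =>
    rw [Finset.sum_Icc_succ_top (by omega), ih]
    rcases Nat.even_or_odd k with hk | hk
    · simp [pow_succ, hk.neg_one_pow, hk.add_one, Nat.not_odd_iff_even.2 hk]
    · simp [pow_succ, hk.neg_one_pow, hk, Nat.not_odd_iff_even.2 hk.add_one]

theorem fib_succ_eq_one_add_sum_Icc_choose (n : ℕ) :
    Nat.fib (n + 1) = 1 + ∑ d ∈ Finset.Icc 1 (n / 2), (n - d).choose d := by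
  have hsub : Finset.range (n / 2 + 1) ⊆ Finset.range (n + 1) :=
    Finset.range_subset_range.2 (by omega)
  rw [Nat.fib_succ_eq_sum_choose, ← Finset.Nat.sum_antidiagonal_swap,
    Finset.Nat.sum_antidiagonal_eq_sum_range_succ_mk]
  simp only [Prod.swap_prod_mk]
  rw [← Finset.sum_subset hsub fun d _ hd => Nat.choose_eq_zero_of_lt (by
      rw [Finset.mem_range] at hd; omega), Finset.range_eq_Ico,
    Finset.sum_eq_sum_Ico_succ_bot (by omega)]
  simp only [Nat.choose_zero_right]
  rfl

theorem alkarkhi_fibonacci_odd (n : ℕ) (hn : 1 ≤ n) (h : Odd (n / 2)) :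
    (Nat.fib (n + 1) : ℤ) = ∑ d ∈ Finset.Icc 1 (n / 2), K (n - d) d := by
  simp only [K, Finset.sum_add_distrib, sum_Icc_neg_one_pow_succ, if_pos h]
  rw [fib_succ_eq_one_add_sum_Icc_choose n]
  push_cast
  ring
end

section
/- For every natural number n ≥ 1 such that ⌊n/2⌋ is even, the (n+1)-th Fibonacci number satisfies F_{n+1} = ∑_{d=1}^{⌊n/2⌋} K(n−d, d) + 1, where the sum runs over the entries of Alkarkhi's triangle along the rising diagonal. -/
theorem Nat.fib_succ_eq_sum_range_choose (n : ℕ) :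
    Nat.fib (n + 1) = ∑ d ∈ Finset.range (n / 2 + 1), (n - d).choose d := by
  rw [Nat.fib_succ_eq_sum_choose, ← Finset.Nat.sum_antidiagonal_swap,
    Finset.Nat.sum_antidiagonal_eq_sum_range_succ_mk]
  symm
  apply Finset.sum_subset
  · intro d hd
    simp only [Finset.mem_range] at hd ⊢
    omega
  · intro d _ hd
    simp only [Finset.mem_range] at hd
    exact Nat.choose_eq_zero_of_lt (by omega)

theorem sum_Icc_neg_one_pow_succ_of_even {m : ℕ} (hm : Even m) :
    ∑ d ∈ Finset.Icc 1 m, (-1 : ℤ) ^ (d + 1) = 0 := by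
  obtain ⟨k, rfl⟩ := hm
  induction k with
  | zero => simp
  | succ k ih =>
    rw [show k + 1 + (k + 1) = k + k + 1 + 1 by ring, Finset.sum_Icc_succ_top (by omega),
      Finset.sum_Icc_succ_top (by omega), ih]
    ring

theorem alkarkhi_fibonacci_even (n : ℕ) (hn : 1 ≤ n) (h : Even (n / 2)) :
    (Nat.fib (n + 1) : ℤ) = ∑ d ∈ Finset.Icc 1 (n / 2), K (n - d) d + 1 := by
  simp only [K]
  rw [Finset.sum_add_distrib, sum_Icc_neg_one_pow_succ_of_even h, add_zero,
    Nat.fib_succ_eq_sum_range_choose, Finset.range_eq_Ico,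
    Finset.sum_eq_sum_Ico_succ_bot (Nat.succ_pos _), Nat.choose_zero_right]
  push_cast
  rw [add_comm]
  rfl
end
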